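/- For any odd positive integer n, there is no pair H, K of unbiased row regular real Hadamard matrices of order 4n². -/

import Mathlib

/-- A real Hadamard matrix of order `m` (with integer entries):
entries in `{1, -1}` and `H * Hᵀ = m • I`. -/
def IsHadamard (m : ℕ) (H : Matrix (Fin m) (Fin m) ℤ) : Prop :=
  (∀ i j, H i j = 1 ∨ H i j = -1) ∧
  H * H.transpose = (m : ℤ) • (1 : Matrix (Fin m) (Fin m) ℤ)

/-- `H` is row regular if every row sum has absolute value `√m`,
i.e. every row sum squares to `m`. -/
def RowRegularZ (m : ℕ) (H : Matrix (Fin m) (Fin m) ℤ) : Prop :=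
  ∀ k, (∑ j, H k j) ^ 2 = (m : ℤ)

/-- Two real Hadamard matrices are unbiased if every entry of `H * Kᵀ` has
absolute value `√m`, i.e. every entry squares to `m`. -/
def RUnbiased (m : ℕ) (H K : Matrix (Fin m) (Fin m) ℤ) : Prop :=
  ∀ i j, ((H * K.transpose) i j) ^ 2 = (m : ℤ)

theorem no_unbiased_rowRegular_hadamard_pair (n : ℕ) (hn : Odd n) :
    ¬ ∃ H K : Matrix (Fin (4 * n ^ 2)) (Fin (4 * n ^ 2)) ℤ,
      IsHadamard (4 * n ^ 2) H ∧ IsHadamard (4 * n ^ 2) K ∧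
      RowRegularZ (4 * n ^ 2) H ∧ RowRegularZ (4 * n ^ 2) K ∧
      RUnbiased (4 * n ^ 2) H K := by
  rintro ⟨H, K, ⟨hH, -⟩, ⟨hK, -⟩, rH, rK, hU⟩
  have hpos : 0 < 4 * n ^ 2 := by
    have := hn.pos
    positivity
  let z : Fin (4 * n ^ 2) := ⟨0, hpos⟩
  have a1 := rH z
  have a2 := rK z
  have a3 := hU z z
  rw [Matrix.mul_apply] at a3
  simp only [Matrix.transpose_apply] at a3
  have hd : (4 : ℤ) ∣ ∑ j, (1 + H z j) * (1 + K z j) := by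
    apply Finset.dvd_sum
    intro j _
    rcases hH z j with h | h <;> rcases hK z j with k | k <;> rw [h, k] <;> norm_num
  have he : ∑ j, (1 + H z j) * (1 + K z j) =
      4 * (n : ℤ) ^ 2 + ∑ j, H z j + ∑ j, K z j + ∑ j, H z j * K z j := by
    have : ∀ j, (1 + H z j) * (1 + K z j) = 1 + H z j + K z j + H z j * K z j := by
      intro j
      ring
    simp only [this, Finset.sum_add_distrib]
    simp
  rw [he] at hd
  have key : ∀ s : ℤ, s ^ 2 = ((4 * n ^ 2 : ℕ) : ℤ) → s = 2 * n ∨ s = -(2 * n) := by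
    intro s hs
    apply sq_eq_sq_iff_eq_or_eq_neg.mp
    rw [hs]
    push_cast
    ring
  obtain ⟨t, rfl⟩ := hn
  rcases key _ a1 with h1 | h1 <;> rcases key _ a2 with h2 | h2 <;>
    rcases key _ a3 with h3 | h3 <;> rw [h1, h2, h3] at hd <;> push_cast at hd <;> omega
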